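/- For every natural number M, the four-loop twist-2 ABJM anomalous dimension evaluated at N = 2M satisfies the reshuffling identity: 16·S_{−3}(2M) + 16·S₃(2M) − 8·S_{−2,−1}(2M) − 8·S_{−2,1}(2M) − 16·S_{−1,−2}(2M) − 16·S_{−1,2}(2M) − 16·S_{1,−2}(2M) − 16·S_{1,2}(2M) − 8·S_{2,−1}(2M) − 8·S_{2,1}(2M) = 4·S₃(M) − 8·S_{1,2}(M) − 4·S_{2,1}(M). -/

import Mathlib

/-- Nested (signed) harmonic sum `S_{a₁,…,a_ℓ}(N)`,
`S_{a₁,…,a_ℓ}(N) = Σ_{n=1}^{N} (sign a₁)^n / n^{|a₁|} · S_{a₂,…,a_ℓ}(n)`, with `S_{}(n) = 1`. -/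
noncomputable def nestedS : List ℤ → ℕ → ℝ
  | [], _ => 1
  | a :: b, N => ∑ n ∈ Finset.Icc 1 N, ((Int.sign a : ℝ)) ^ n / (n : ℝ) ^ a.natAbs * nestedS b n

/-- Adding the sums with first index `a` and `-a` keeps only the even summation indices. -/
theorem nestedS_cons_add_nestedS_neg_cons (a : ℕ) (ha : 0 < a) (b : List ℤ) (M : ℕ) :
    nestedS ((a : ℤ) :: b) (2 * M) + nestedS (-(a : ℤ) :: b) (2 * M) =
      2 / 2 ^ a * ∑ m ∈ Finset.Icc 1 M, 1 / (m : ℝ) ^ a * nestedS b (2 * m) := by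
  have hs : Int.sign (a : ℤ) = 1 := Int.sign_eq_one_of_pos (by exact_mod_cast ha)
  simp only [nestedS, Int.sign_neg, hs, Int.natAbs_neg, Int.natAbs_natCast]
  induction M with
  | zero => simp
  | succ k ih =>
    rw [show 2 * (k + 1) = 2 * k + 1 + 1 by ring]
    simp only [Finset.sum_Icc_succ_top (Nat.le_add_left 1 _)]
    rw [mul_add, ← ih, show 2 * (k + 1) = 2 * k + 1 + 1 by ring,
      show ((2 * k + 1 + 1 : ℕ) : ℝ) = 2 * ((k + 1 : ℕ) : ℝ) by push_cast; ring, mul_pow]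
    have h : ((-1 : ℝ)) ^ (2 * k) = 1 := by simp
    simp only [Int.cast_one, Int.cast_neg, pow_succ (-1 : ℝ), h, one_pow]
    ring

/-- Depth-one case of the doubling relation. -/
theorem nestedS_singleton_two_mul (a : ℕ) (ha : 0 < a) (M : ℕ) :
    nestedS [(a : ℤ)] (2 * M) + nestedS [-(a : ℤ)] (2 * M) = 2 / 2 ^ a * nestedS [(a : ℤ)] M := by
  have hs : Int.sign (a : ℤ) = 1 := Int.sign_eq_one_of_pos (by exact_mod_cast ha)
  rw [nestedS_cons_add_nestedS_neg_cons a ha]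
  simp [nestedS, hs]

/-- Depth-two case of the doubling relation. -/
theorem nestedS_pair_two_mul (a b : ℕ) (ha : 0 < a) (hb : 0 < b) (M : ℕ) :
    nestedS [(a : ℤ), (b : ℤ)] (2 * M) + nestedS [-(a : ℤ), (b : ℤ)] (2 * M) +
        (nestedS [(a : ℤ), -(b : ℤ)] (2 * M) + nestedS [-(a : ℤ), -(b : ℤ)] (2 * M)) =
      2 / 2 ^ a * (2 / 2 ^ b) * nestedS [(a : ℤ), (b : ℤ)] M := by
  have hs : Int.sign (a : ℤ) = 1 := Int.sign_eq_one_of_pos (by exact_mod_cast ha)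
  rw [nestedS_cons_add_nestedS_neg_cons a ha, nestedS_cons_add_nestedS_neg_cons a ha,
    ← mul_add, ← Finset.sum_add_distrib, mul_assoc, nestedS]
  congr 1
  rw [Finset.mul_sum]
  refine Finset.sum_congr rfl fun m _ => ?_
  rw [← mul_add, nestedS_singleton_two_mul b hb, hs, Int.natAbs_natCast, Int.cast_one, one_pow]
  ring

/-- Reshuffling of the four-loop twist-2 ABJM anomalous dimension at even spin `N = 2M`:
`γ₄^{ABA}(2M) = 4·S₃(M) − 8·S_{1,2}(M) − 4·S_{2,1}(M)`. -/
theorem twist2_four_loop_reshuffling (M : ℕ) :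
    16 * nestedS [-3] (2 * M) + 16 * nestedS [3] (2 * M) - 8 * nestedS [-2, -1] (2 * M) - 8 * nestedS [-2, 1] (2 * M) - 16 * nestedS [-1, -2] (2 * M) - 16 * nestedS [-1, 2] (2 * M) - 16 * nestedS [1, -2] (2 * M) - 16 * nestedS [1, 2] (2 * M) - 8 * nestedS [2, -1] (2 * M) - 8 * nestedS [2, 1] (2 * M)
      = 4 * nestedS [3] M - 8 * nestedS [1, 2] M - 4 * nestedS [2, 1] M := by
  have h₃ := nestedS_singleton_two_mul 3 (by norm_num) M
  have h₁₂ := nestedS_pair_two_mul 1 2 (by norm_num) (by norm_num) M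
  have h₂₁ := nestedS_pair_two_mul 2 1 (by norm_num) (by norm_num) M
  push_cast at h₃ h₁₂ h₂₁
  norm_num at h₃ h₁₂ h₂₁
  linarith
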